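/- arXiv:0905.4588 — 3 statements merged into one kernel-verified Lean document; each statement's English description precedes it below -/
import Mathlib

section
/- Let q = 2p with p ≥ 2 be an even integer, λ = 2cos(π/q), and let α ∈ (α₀, 1/2). Then l_{p−1} < 0 < r_{p−1}, the digits satisfy d_α(l_{p−1}) = d_α(r_{p−1}) + 1, and the orbits merge at step p: l_p = r_p. -/
open Real MeasureTheory Set

/-- The digit function `d_α(x) = ⌊|1/(λx)| + 1 − α⌋`. -/
noncomputable def rosenD (lam a x : ℝ) : ℤ := ⌊|1 / (lam * x)| + 1 - a⌋

/-- The α-Rosen map `T_α`. -/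
noncomputable def rosenT (lam a : ℝ) (x : ℝ) : ℝ :=
  if x = 0 then 0 else |1 / x| - lam * rosenD lam a x

/-- The planar map `𝒯_α(x,y) = (T_α(x), 1/(d_α(x)λ + ε(x)·y))`. -/
noncomputable def rosenTT (lam a : ℝ) (z : ℝ × ℝ) : ℝ × ℝ :=
  (rosenT lam a z.1, 1 / ((rosenD lam a z.1 : ℝ) * lam + Real.sign z.1 * z.2))

/-- If `|1/x| - λ` already lies in `I_α`, then the digit of `x` is `1`. -/
lemma rosenT_eq_of_mem {lam a x : ℝ} (hlam : 0 < lam) (hx : x ≠ 0)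
    (h1 : (a - 1) * lam ≤ |1 / x| - lam) (h2 : |1 / x| - lam < a * lam) :
    rosenT lam a x = |1 / x| - lam := by
  have hd : rosenD lam a x = 1 := by
    have e : |1 / (lam * x)| = |1 / x| / lam := by
      rw [one_div, mul_inv, abs_mul, abs_of_pos (inv_pos.2 hlam), one_div]
      field_simp
    have h3 : a ≤ |1 / x| / lam := by rw [le_div_iff₀ hlam]; linarith
    have h4 : |1 / x| / lam < a + 1 := by rw [div_lt_iff₀ hlam]; linarith
    rw [rosenD, e, Int.floor_eq_iff]
    push_cast
    constructor <;> linarith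
  simp [rosenT, hx, hd]

/-- A stretch of the orbit along which every digit is `1` and every point, except possibly the
last, is negative. The points are ratios of consecutive terms of a linear recurrence. -/
lemma rosenT_iterate_neg_ratio {lam a : ℝ} (hlam : 0 < lam) (hlam2 : lam < 2) (ha : 0 < a)
    {Y : ℕ → ℝ} (hY : ∀ k, Y (k + 2) = lam * Y (k + 1) - Y k)
    (hend : -Y 0 / Y 1 < a * lam) (m : ℕ) (hpos : ∀ k, 1 ≤ k → k ≤ m + 1 → 0 < Y k)
    (hx : (a - 1) * lam ≤ -Y m / Y (m + 1)) :
    (rosenT lam a)^[m] (-Y m / Y (m + 1)) = -Y 0 / Y 1 := by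
  induction m with
  | zero => rfl
  | succ m ih =>
    have p1 : 0 < Y (m + 1) := hpos _ (by omega) (by omega)
    have p2 : 0 < Y (m + 2) := hpos _ (by omega) (by omega)
    have hneg : -Y (m + 1) / Y (m + 1 + 1) < 0 := div_neg_of_neg_of_pos (by linarith) p2
    have hS : |1 / (-Y (m + 1) / Y (m + 1 + 1))| - lam = -Y m / Y (m + 1) := by
      rw [one_div, abs_of_neg (inv_lt_zero.2 hneg), show m + 1 + 1 = m + 2 from rfl]
      have := hY m
      field_simp
      linarith
    have hinc : -Y (m + 1) / Y (m + 1 + 1) ≤ -Y m / Y (m + 1) := by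
      rw [show m + 1 + 1 = m + 2 from rfl, div_le_div_iff₀ p2 p1]
      have e : Y m = lam * Y (m + 1) - Y (m + 2) := by linarith [hY m]
      rw [e]
      nlinarith [sq_nonneg (Y (m + 1) - Y (m + 2)), mul_pos p1 p2]
    have hlt : -Y m / Y (m + 1) < a * lam := by
      rcases Nat.eq_zero_or_pos m with rfl | hm
      · exact hend
      · have := hpos m hm (by omega)
        exact (div_neg_of_neg_of_pos (by linarith) p1).trans (mul_pos ha hlam)
    have hT : rosenT lam a (-Y (m + 1) / Y (m + 1 + 1)) = -Y m / Y (m + 1) := by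
      rw [rosenT_eq_of_mem hlam hneg.ne (by rw [hS]; exact hx.trans hinc) (by rw [hS]; exact hlt),
        hS]
    rw [Function.iterate_succ_apply, hT]
    exact ih (fun k h1 h2 => hpos k h1 (by omega)) (hx.trans hinc)

/-- Two points of opposite sign whose reciprocals have absolute values differing by `λ` have
digits differing by one, and the same image. -/
lemma rosenD_rosenT_of_abs_inv {lam a x y : ℝ} (hlam : 0 < lam) (hx : x < 0) (hy : 0 < y)
    (h : |1 / x| = |1 / y| + lam) :
    rosenD lam a x = rosenD lam a y + 1 ∧ rosenT lam a x = rosenT lam a y := by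
  have e : ∀ z : ℝ, |1 / (lam * z)| = |1 / z| / lam := fun z => by
    rw [one_div, mul_inv, abs_mul, abs_of_pos (inv_pos.2 hlam), one_div]
    field_simp
  have hd : rosenD lam a x = rosenD lam a y + 1 := by
    rw [rosenD, rosenD, e, e, h, ← Int.floor_add_one]
    congr 1
    field_simp
    ring
  refine ⟨hd, ?_⟩
  rw [rosenT, rosenT, if_neg hx.ne, if_neg hy.ne', hd, h]
  push_cast
  ring

lemma cos_sin_linear_recurrence (c d t : ℝ) (k : ℕ) :
    c * cos ((k + 2 : ℕ) * t) + d * sin ((k + 2 : ℕ) * t) =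
      2 * cos t * (c * cos ((k + 1 : ℕ) * t) + d * sin ((k + 1 : ℕ) * t)) -
        (c * cos (k * t) + d * sin (k * t)) := by
  have e1 : ((k + 2 : ℕ) : ℝ) * t = (k + 1 : ℕ) * t + t := by push_cast; ring
  have e2 : (k : ℝ) * t = (k + 1 : ℕ) * t - t := by push_cast; ring
  rw [e1, e2, cos_add, sin_add, cos_sub, sin_sub]
  ring

/-- for even `q = 2p`, `α ∈ (α₀, 1/2)`: `l_{p−1} < 0 < r_{p−1}`,
`d_α(l_{p−1}) = d_α(r_{p−1}) + 1`, and `l_p = r_p`. -/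
theorem stmt4 (p q : ℕ) (hp : 2 ≤ p) (hq : q = 2 * p)
    (lam : ℝ) (hlam : lam = 2 * Real.cos (Real.pi / (q : ℝ)))
    (a : ℝ)
    (ha0 : (lam ^ 2 - 4 + Real.sqrt ((4 - lam ^ 2) ^ 2 + 4 * lam ^ 2)) / (2 * lam ^ 2) < a)
    (ha1 : a < 1 / 2) :
    (rosenT lam a)^[p - 1] ((a - 1) * lam) < 0 ∧
    0 < (rosenT lam a)^[p - 1] (a * lam) ∧
    rosenD lam a ((rosenT lam a)^[p - 1] ((a - 1) * lam)) =
      rosenD lam a ((rosenT lam a)^[p - 1] (a * lam)) + 1 ∧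
    (rosenT lam a)^[p] ((a - 1) * lam) = (rosenT lam a)^[p] (a * lam) := by
  obtain ⟨m, rfl⟩ : ∃ m, p = m + 2 := ⟨p - 2, by omega⟩
  set t := π / (q : ℝ) with ht
  have hq4 : (4 : ℝ) ≤ q := by rw [hq]; exact_mod_cast (by omega : 4 ≤ 2 * (m + 2))
  have ht0 : 0 < t := by positivity
  have ht4 : t ≤ π / 4 := div_le_div_of_nonneg_left pi_pos.le (by norm_num) hq4
  have hpt : ((m + 2 : ℕ) : ℝ) * t = π / 2 := by
    rw [ht, hq]; push_cast; field_simp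
  have hs : 0 < sin t := sin_pos_of_pos_of_lt_pi ht0 (by linarith [pi_pos])
  have hc0 : 0 < cos t := cos_pos_of_mem_Ioo ⟨by linarith [pi_pos], by linarith [pi_pos]⟩
  have hsc := sin_sq_add_cos_sq t
  have hlam0 : 0 < lam := by rw [hlam]; linarith
  have hlam4 : lam ^ 2 < 4 := by rw [hlam]; nlinarith
  have hlam2 : lam < 2 := by nlinarith
  have hlamsq : 2 ≤ lam ^ 2 := by
    have : 0 ≤ cos (2 * t) :=
      cos_nonneg_of_mem_Icc ⟨by linarith [pi_pos], by linarith [pi_pos]⟩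
    rw [cos_two_mul] at this
    rw [hlam]; nlinarith
  have hquad : 0 < lam ^ 2 * a ^ 2 + (4 - lam ^ 2) * a - 1 := by
    rw [div_lt_iff₀ (by positivity)] at ha0
    have h1 : √((4 - lam ^ 2) ^ 2 + 4 * lam ^ 2) < 2 * lam ^ 2 * a + (4 - lam ^ 2) := by linarith
    have h2 := (sqrt_lt' ((sqrt_nonneg _).trans_lt h1)).1 h1
    have h3 : 0 < 4 * lam ^ 2 * (lam ^ 2 * a ^ 2 + (4 - lam ^ 2) * a - 1) := by linarith
    exact (pos_iff_pos_of_mul_pos h3).1 (by positivity)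
  have hbeta : lam ^ 2 - 2 < lam ^ 2 * a := by
    rw [div_lt_iff₀ (by positivity)] at ha0
    have h1 : lam ^ 2 ≤ √((4 - lam ^ 2) ^ 2 + 4 * lam ^ 2) := by
      apply le_sqrt_of_sq_le
      nlinarith
    linarith
  have ha : 0 < a := by
    by_contra! h
    nlinarith [mul_nonneg (sq_nonneg lam) (neg_nonneg.2 h)]
  set d := (1 / 2 - a) * lam with hd
  have hd0 : 0 < d := mul_pos (by linarith) hlam0
  have hden : 0 < sin t ^ 2 - d * cos t := by
    have : cos t = lam / 2 := by linarith
    have h5 : sin t ^ 2 = 1 - cos t ^ 2 := by linarith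
    rw [h5, this, hd]
    nlinarith
  let Y : ℝ → ℕ → ℝ := fun c k => c * cos (k * t) + sin t * sin (k * t)
  have hY : ∀ c k, Y c (k + 2) = lam * Y c (k + 1) - Y c k := fun c k => by
    rw [hlam]; exact cos_sin_linear_recurrence c (sin t) t k
  have hY0 : ∀ c, Y c 0 = c := fun c => by simp [Y]
  have hY1 : ∀ c, Y c 1 = c * cos t + sin t ^ 2 := fun c => by simp [Y]; ring
  have hYp : ∀ c, Y c (m + 2) = sin t := fun c => by
    simp only [Y, hpt]; simp
  have hYp1 : ∀ c, Y c (m + 1) = sin t * (c + cos t) := fun c => by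
    have : ((m + 1 : ℕ) : ℝ) * t = π / 2 - t := by rw [← hpt]; push_cast; ring
    simp only [Y, this, cos_pi_div_two_sub, sin_pi_div_two_sub]; ring
  have hang : ∀ k, k ≤ m + 2 → (k : ℝ) * t ≤ π / 2 := fun k hk => by
    rw [← hpt]
    exact mul_le_mul_of_nonneg_right (by exact_mod_cast hk) ht0.le
  have hangle : ∀ k : ℕ, 1 ≤ k → t ≤ (k : ℝ) * t := fun k hk =>
    le_mul_of_one_le_left ht0.le (by exact_mod_cast hk)
  have hposl : ∀ k, 1 ≤ k → k ≤ m + 1 + 1 → 0 < Y d k := fun k h1 h2 => by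
    have hc := cos_nonneg_of_mem_Icc
      (show (k : ℝ) * t ∈ Icc (-(π / 2)) (π / 2) from ⟨by linarith [hangle k h1], hang k h2⟩)
    have hsn : 0 < sin (k * t) := sin_pos_of_pos_of_lt_pi
      (by linarith [hangle k h1]) (by linarith [hang k h2, pi_pos])
    have := mul_nonneg hd0.le hc
    have := mul_pos hs hsn
    simp only [Y]; linarith
  have hposr : ∀ k, 1 ≤ k → k ≤ m + 1 → 0 < Y (-d) k := fun k h1 h2 => by
    have hc : cos (k * t) ≤ cos t := cos_le_cos_of_nonneg_of_le_pi ht0.le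
      (by linarith [hang k (by omega), pi_pos]) (hangle k h1)
    have hsn : sin t ≤ sin (k * t) := sin_le_sin_of_le_of_le_pi_div_two
      (by linarith) (hang k (by omega)) (hangle k h1)
    have := mul_le_mul_of_nonneg_left hc hd0.le
    have := mul_le_mul_of_nonneg_left hsn hs.le
    simp only [Y]; nlinarith
  have hl : (rosenT lam a)^[m + 1] ((a - 1) * lam) = -d / (d * cos t + sin t ^ 2) := by
    have e : (a - 1) * lam = -Y d (m + 1) / Y d (m + 1 + 1) := by
      rw [show m + 1 + 1 = m + 2 from rfl, hYp, hYp1]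
      field_simp
      rw [hd]; linarith
    have h := rosenT_iterate_neg_ratio hlam0 hlam2 ha (hY d)
      ((div_neg_of_neg_of_pos (by rw [hY0]; linarith) (hposl 1 le_rfl (by omega))).trans
        (mul_pos ha hlam0)) (m + 1) hposl e.le
    rw [← e, hY0, hY1] at h
    exact h
  have hr : (rosenT lam a)^[m + 1] (a * lam) = d / (sin t ^ 2 - d * cos t) := by
    have hal : 0 < a * lam := mul_pos ha hlam0
    have hsum : -d + cos t = a * lam := by rw [hd]; linarith
    have hend : -Y (-d) 0 / Y (-d) 1 < a * lam := by
      rw [hY0, hY1, div_lt_iff₀ (by linarith)]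
      have h5 : sin t ^ 2 = 1 - cos t ^ 2 := by linarith
      have h6 : cos t = lam / 2 := by linarith
      rw [h5, h6, hd]
      nlinarith [mul_pos hlam0 hquad]
    have e : |1 / (a * lam)| - lam = -Y (-d) m / Y (-d) (m + 1) := by
      have h7 : Y (-d) m = lam * (sin t * (a * lam)) - sin t := by
        have := hY (-d) m
        rw [hYp, hYp1, hsum] at this
        linarith
      rw [abs_of_pos (by positivity), h7, hYp1, hsum]
      field_simp
      ring
    have hge : (a - 1) * lam ≤ |1 / (a * lam)| - lam := by
      rw [abs_of_pos (by positivity)]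
      have h8 : a * lam ≤ 1 := by nlinarith
      have : 1 ≤ 1 / (a * lam) := by rwa [le_div_iff₀ hal, one_mul]
      linarith
    have hlt : |1 / (a * lam)| - lam < a * lam := by
      rw [e]
      rcases Nat.eq_zero_or_pos m with rfl | hm
      · exact hend
      · have := hposr m hm (by omega)
        exact (div_neg_of_neg_of_pos (by linarith) (hposr (m + 1) (by omega) le_rfl)).trans hal
    rw [Function.iterate_succ_apply, rosenT_eq_of_mem hlam0 hal.ne' hge hlt, e,
      rosenT_iterate_neg_ratio hlam0 hlam2 ha (hY (-d)) hend m hposr (by rw [← e]; exact hge),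
      hY0, hY1]
    congr 1 <;> ring
  have hl0 : -d / (d * cos t + sin t ^ 2) < 0 :=
    div_neg_of_neg_of_pos (by linarith) (by positivity)
  have hr0 : 0 < d / (sin t ^ 2 - d * cos t) := div_pos hd0 hden
  have habs : |1 / (-d / (d * cos t + sin t ^ 2))| = |1 / (d / (sin t ^ 2 - d * cos t))| + lam := by
    rw [abs_of_neg (one_div_neg.2 hl0), abs_of_pos (one_div_pos.2 hr0), one_div_div, one_div_div,
      hlam]
    field_simp
    ring
  obtain ⟨h1, h2⟩ := rosenD_rosenT_of_abs_inv (a := a) hlam0 hl0 hr0 habs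
  rw [show m + 2 - 1 = m + 1 from rfl, show m + 2 = (m + 1) + 1 from rfl,
    Function.iterate_succ_apply' _ (m + 1), Function.iterate_succ_apply' _ (m + 1), hl, hr]
  exact ⟨hl0, hr0, h1, h2⟩
end

section
/- Let q = 2h+3 with h ≥ 1 be an odd integer, λ = 2cos(π/q), and let α ∈ (α₀, 1/2). Then l_{2h+1} < 0 < r_{2h+1}, the digits satisfy d_α(l_{2h+1}) = d_α(r_{2h+1}) + 1, and the orbits merge: l_{2h+2} = r_{2h+2}. -/
open Real MeasureTheory Set

theorem rosenT_neg (lam a x : ℝ) : rosenT lam a (-x) = rosenT lam a x := by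
  simp [rosenT, rosenD]

theorem rosenT_eq_of_mem_s13 {lam a x y : ℝ} (d : ℤ) (hlam : 0 < lam) (hx : x < 0)
    (hy : y = -1 / x - lam * d) (hl : (a - 1) * lam ≤ y) (hr : y < a * lam) :
    rosenT lam a x = y := by
  have habs : |1 / x| = -1 / x := by
    rw [abs_of_neg (one_div_neg.mpr hx)]; ring
  have habs' : |1 / (lam * x)| = y / lam + d := by
    rw [abs_of_neg (one_div_neg.mpr (mul_neg_of_pos_of_neg hlam hx)), hy]
    field_simp
    ring
  have hfloor : rosenD lam a x = d := by
    rw [rosenD, habs', Int.floor_eq_iff]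
    have h1 : a - 1 ≤ y / lam := (le_div_iff₀ hlam).mpr hl
    have h2 : y / lam < a := (div_lt_iff₀ hlam).mpr hr
    constructor <;> linarith
  rw [rosenT, if_neg hx.ne, habs, hfloor, hy]

/-- The inverse branch with digit one and negative sign moves points to the right. -/
theorem lt_neg_inv_sub {lam x : ℝ} (h0 : 0 < lam) (h2 : lam < 2) (hx : x < 0) :
    x < -1 / x - lam := by
  have : -1 / x - lam - x = (x ^ 2 + lam * x + 1) / -x := by
    have := hx.ne
    field_simp
    ring
  have hpos : 0 < (x ^ 2 + lam * x + 1) / -x := by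
    apply div_pos _ (by linarith)
    nlinarith [sq_nonneg (x + 1)]
  linarith

theorem sin_add_two_mul (n : ℕ) (t : ℝ) :
    sin ((n + 2 : ℕ) * t) = 2 * cos t * sin ((n + 1 : ℕ) * t) - sin (n * t) := by
  have e1 : ((n + 2 : ℕ) : ℝ) * t = (n + 1 : ℕ) * t + t := by push_cast; ring
  have e2 : (n : ℝ) * t = (n + 1 : ℕ) * t - t := by push_cast; ring
  rw [e1, e2, sin_add, sin_sub]
  ring

theorem sin_mul_sin_add_two_mul (n : ℕ) (t : ℝ) :
    sin (n * t) * sin ((n + 2 : ℕ) * t) = sin ((n + 1 : ℕ) * t) ^ 2 - sin t ^ 2 := by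
  have e1 : ((n + 2 : ℕ) : ℝ) * t = (n + 1 : ℕ) * t + t := by push_cast; ring
  have e2 : (n : ℝ) * t = (n + 1 : ℕ) * t - t := by push_cast; ring
  rw [e1, e2, sin_add, sin_sub]
  nlinarith [sin_sq_add_cos_sq t, sin_sq_add_cos_sq (((n + 1 : ℕ) : ℝ) * t)]

/-- A run of negative points with digit one, in closed form. -/
theorem rosenT_iterate_neg {t lam a s : ℝ} (hlam : lam = 2 * cos t) (h0 : 0 < lam)
    (h2 : lam < 2) (ha : 0 < a) (hs : s ≤ (1 - a) * lam) (n : ℕ)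
    (hpos : ∀ k : ℕ, 0 < k → k ≤ n + 1 → 0 < sin (k * t))
    (hn : sin (n * t) < sin ((n + 1 : ℕ) * t) * s) :
    (rosenT lam a)^[n] (-s) = -(sin ((n + 1 : ℕ) * t) * s - sin (n * t)) /
        (sin (n * t) * s - lam * sin (n * t) + sin ((n + 1 : ℕ) * t)) ∧
      (rosenT lam a)^[n] (-s) < 0 ∧ -s ≤ (rosenT lam a)^[n] (-s) := by
  induction n with
  | zero =>
    have h1 := hpos 1 one_pos le_rfl
    simp only [Nat.cast_one, one_mul] at h1
    simp only [CharP.cast_eq_zero, zero_mul, sin_zero, zero_add, Nat.cast_one, one_mul] at hn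
    have hs0 : 0 < s := pos_of_mul_pos_right hn h1.le
    refine ⟨?_, by simpa using hs0, le_rfl⟩
    simp only [Function.iterate_zero, id_eq, CharP.cast_eq_zero, zero_mul, sin_zero, zero_add,
      Nat.cast_one, one_mul, mul_zero, sub_zero]
    field_simp
  | succ n ih =>
    have p1 := hpos (n + 1) (by omega) (by omega)
    have p2 := hpos (n + 2) (by omega) (by omega)
    have hst : 0 < sin t := by simpa using hpos 1 one_pos (by omega)
    have cas := sin_mul_sin_add_two_mul n t
    have rec2 := sin_add_two_mul n t
    rw [← hlam] at rec2
    have hn' : sin (n * t) < sin ((n + 1 : ℕ) * t) * s := by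
      have : sin (n * t) * sin ((n + 2 : ℕ) * t) <
          sin ((n + 1 : ℕ) * t) * s * sin ((n + 2 : ℕ) * t) := by
        nlinarith [mul_lt_mul_of_pos_left hn p1, pow_pos hst 2]
      exact lt_of_mul_lt_mul_right this p2.le
    obtain ⟨ih1, ih2, ih3⟩ := ih (fun k hk hk' => hpos k hk (by omega)) hn'
    have hn1 : sin ((n + 1 : ℕ) * t) < sin ((n + 2 : ℕ) * t) * s := hn
    rw [Function.iterate_succ_apply']
    set x := (rosenT lam a)^[n] (-s)
    change rosenT lam a x = -(sin ((n + 2 : ℕ) * t) * s - sin ((n + 1 : ℕ) * t)) /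
        (sin ((n + 1 : ℕ) * t) * s - lam * sin ((n + 1 : ℕ) * t) + sin ((n + 2 : ℕ) * t)) ∧ _
    generalize sin ((n + 2 : ℕ) * t) = b2 at *
    generalize sin ((n + 1 : ℕ) * t) = b1 at *
    generalize sin ((n : ℝ) * t) = b0 at *
    have hy : -1 / x - lam = -(b2 * s - b1) / (b1 * s - lam * b1 + b2) := by
      have hnum : b1 * s - b0 ≠ 0 := by linarith
      have e : b1 * s - lam * b1 + b2 = b1 * s - b0 := by rw [rec2]; ring
      have hden : b0 * s - lam * b0 + b1 ≠ 0 := by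
        intro h
        rw [h, div_zero] at ih1
        exact ih2.ne ih1
      rw [ih1, e, rec2]
      field_simp
      ring
    have hneg : -1 / x - lam < 0 := by
      rw [hy]
      apply div_neg_of_neg_of_pos
      · linarith
      · rw [rec2]; linarith
    have hlt := lt_neg_inv_sub h0 h2 ih2
    have hT : rosenT lam a x = -1 / x - lam :=
      rosenT_eq_of_mem_s13 1 h0 ih2 (by push_cast; ring) (by linarith)
        (by nlinarith [mul_pos ha h0])
    rw [hT]
    exact ⟨hy, hneg, by linarith⟩

/-- The orbit of `-s` following the digits `1, …, 1, 2, 1, …, 1`. -/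
theorem rosenT_iterate_two_mul_add_one {m : ℕ} {t lam a s : ℝ} (ht : t = π / (2 * m + 5 : ℕ))
    (hlam : lam = 2 * cos t) (h1 : 1 < lam) (h2 : lam < 2) (ha : 0 < a)
    (hs : s ≤ (1 - a) * lam) (hs1 : 2 * lam - 2 < lam * s)
    (hs2 : (lam + 1) * s - lam ^ 2 + lam - 1 ≤ (1 - a) * lam * (s - lam + 1))
    (hs3 : -(2 * s - lam) / (lam * s - 2 * lam + 2) < a * lam) :
    (rosenT lam a)^[2 * (m + 1) + 1] (-s) = -(2 * s - lam) / (lam * s - 2 * lam + 2) := by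
  have h0 : 0 < lam := by linarith
  have hq : (0 : ℝ) < (2 * m + 5 : ℕ) := by positivity
  have hqt : ((2 * m + 5 : ℕ) : ℝ) * t = π := by rw [ht]; field_simp
  have ht0 : 0 < t := by rw [ht]; positivity
  have hpos : ∀ k : ℕ, 0 < k → k ≤ m + 3 → 0 < sin (k * t) := by
    intro k hk hk'
    apply sin_pos_of_pos_of_lt_pi
    · positivity
    · rw [← hqt]
      apply mul_lt_mul_of_pos_right _ ht0
      exact_mod_cast (by omega : k < 2 * m + 5)
  have hsl : lam - 1 < s := by
    have : lam * (lam - 1) < lam * s := by nlinarith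
    exact lt_of_mul_lt_mul_left this h0.le
  have hsym : sin ((m + 3 : ℕ) * t) = sin ((m + 2 : ℕ) * t) := by
    rw [← sin_pi_sub, ← hqt]
    congr 1
    push_cast
    ring
  have rec1 := sin_add_two_mul (m + 1) t
  have rec0 := sin_add_two_mul m t
  rw [← hlam] at rec0 rec1
  have p2 := hpos (m + 2) (by omega) (by omega)
  have e1 : sin ((m + 1 : ℕ) * t) = (lam - 1) * sin ((m + 2 : ℕ) * t) := by
    change sin ((m + 3 : ℕ) * t) = lam * sin ((m + 2 : ℕ) * t) - sin ((m + 1 : ℕ) * t) at rec1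
    linarith
  have e0 : sin (m * t) = (lam ^ 2 - lam - 1) * sin ((m + 2 : ℕ) * t) := by
    rw [e1] at rec0
    linarith
  have hgold : 0 ≤ lam ^ 2 - lam - 1 := by
    have : 0 ≤ sin (m * t) := by
      rcases m.eq_zero_or_pos with rfl | hm
      · simp
      · exact (hpos m hm (by omega)).le
    rw [e0] at this
    exact nonneg_of_mul_nonneg_left this p2
  obtain ⟨hx, hxneg, -⟩ := rosenT_iterate_neg hlam h0 h2 ha hs (m + 1)
    (fun k hk hk' => hpos k hk (by omega)) (by
      change sin ((m + 1 : ℕ) * t) < sin ((m + 2 : ℕ) * t) * s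
      rw [e1]; nlinarith)
  set x := (rosenT lam a)^[m + 1] (-s)
  change x = -(sin ((m + 2 : ℕ) * t) * s - sin ((m + 1 : ℕ) * t)) /
    (sin ((m + 1 : ℕ) * t) * s - lam * sin ((m + 1 : ℕ) * t) + sin ((m + 2 : ℕ) * t)) at hx
  have hsl' : 0 < s - lam + 1 := by linarith
  have hxd : 0 < (lam - 1) * s - lam ^ 2 + lam + 1 := by nlinarith
  have hx' : x = -(s - lam + 1) / ((lam - 1) * s - lam ^ 2 + lam + 1) := by
    have : (lam - 1) * sin ((m + 2 : ℕ) * t) * s - lam * ((lam - 1) * sin ((m + 2 : ℕ) * t)) +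
        sin ((m + 2 : ℕ) * t) =
        sin ((m + 2 : ℕ) * t) * ((lam - 1) * s - lam ^ 2 + lam + 1) := by ring
    rw [hx, e1, this]
    field_simp
    ring
  set s' := ((lam + 1) * s - lam ^ 2 + lam - 1) / (s - lam + 1) with hs'
  have hs'le : s' ≤ (1 - a) * lam := (div_le_iff₀ hsl').mpr hs2
  have hs'gt : (lam ^ 2 - lam - 1) < (lam - 1) * s' := by
    rw [hs', ← mul_div_assoc, lt_div_iff₀ hsl']
    nlinarith
  have hs'pos : -s' < a * lam := by
    have : 0 < (lam - 1) * s' := by linarith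
    have : 0 < s' := pos_of_mul_pos_right this (by linarith)
    nlinarith
  have hTx : rosenT lam a x = -s' := by
    refine rosenT_eq_of_mem_s13 2 h0 hxneg ?_ (by linarith) hs'pos
    rw [hx', hs']
    push_cast
    field_simp
    ring
  obtain ⟨hz, hzneg, hzge⟩ := rosenT_iterate_neg hlam h0 h2 ha hs'le m
    (fun k hk hk' => hpos k hk (by omega)) (by rw [e1, e0]; nlinarith)
  have hsplit : (rosenT lam a)^[2 * (m + 1) + 1] (-s) =
      rosenT lam a ((rosenT lam a)^[m] (-s')) := by
    rw [← hTx, ← Function.iterate_succ_apply' (rosenT lam a) (m + 1) (-s),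
      ← Function.iterate_add_apply, ← Function.iterate_succ_apply' (rosenT lam a)]
    congr 1
    omega
  rw [hsplit]
  set z := (rosenT lam a)^[m] (-s')
  have hd : 0 < lam * s - 2 * lam + 2 := by linarith
  have hzform : z = -((lam - 1) * s' - (lam ^ 2 - lam - 1)) /
      ((lam ^ 2 - lam - 1) * s' - lam * (lam ^ 2 - lam - 1) + (lam - 1)) := by
    have : (lam ^ 2 - lam - 1) * sin ((m + 2 : ℕ) * t) * s' -
        lam * ((lam ^ 2 - lam - 1) * sin ((m + 2 : ℕ) * t)) +
        (lam - 1) * sin ((m + 2 : ℕ) * t) = sin ((m + 2 : ℕ) * t) *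
        ((lam ^ 2 - lam - 1) * s' - lam * (lam ^ 2 - lam - 1) + (lam - 1)) := by ring
    have this' : -((lam - 1) * sin ((m + 2 : ℕ) * t) * s' -
        (lam ^ 2 - lam - 1) * sin ((m + 2 : ℕ) * t)) = sin ((m + 2 : ℕ) * t) *
        -((lam - 1) * s' - (lam ^ 2 - lam - 1)) := by ring
    rw [hz, e1, e0, this, this', mul_div_mul_left _ _ p2.ne']
  have hy : -(2 * s - lam) / (lam * s - 2 * lam + 2) = -1 / z - lam := by
    have hnum : (lam - 1) * s' - (lam ^ 2 - lam - 1) =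
        (lam * s - 2 * lam + 2) / (s - lam + 1) := by
      rw [hs']
      field_simp
      ring
    have hden : (lam ^ 2 - lam - 1) * s' - lam * (lam ^ 2 - lam - 1) + (lam - 1) =
        ((lam ^ 2 - 2) * s - 2 * lam ^ 2 + 3 * lam) / (s - lam + 1) := by
      rw [hs']
      field_simp
      ring
    rw [hzform, hnum, hden, ← neg_div, div_div_div_cancel_right₀ hsl'.ne', div_div_eq_mul_div,
      neg_one_mul, neg_div_neg_eq, div_sub' hd.ne']
    congr 1
    ring
  have hlt := lt_neg_inv_sub h0 h2 hzneg
  refine rosenT_eq_of_mem_s13 1 h0 hzneg (by rw [hy]; push_cast; ring) ?_ hs3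
  rw [hy]
  linarith

/-- Points of opposite sign with `1 / x + 1 / y = -λ` have digits differing by one and the same
image. -/
theorem rosenD_rosenT_of_inv_add_inv {lam x y : ℝ} (a : ℝ) (hlam : 0 < lam) (hx : x < 0)
    (hy : 0 < y) (hxy : 1 / x + 1 / y = -lam) :
    rosenD lam a x = rosenD lam a y + 1 ∧ rosenT lam a x = rosenT lam a y := by
  have hD : rosenD lam a x = rosenD lam a y + 1 := by
    have e : |1 / (lam * x)| = |1 / (lam * y)| + 1 := by
      rw [abs_of_neg (one_div_neg.mpr (mul_neg_of_pos_of_neg hlam hx)),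
        abs_of_pos (one_div_pos.mpr (mul_pos hlam hy)), ← div_div, ← div_div]
      have : 1 / x = -lam - 1 / y := by linarith
      rw [div_right_comm, this]
      field_simp
      ring
    rw [rosenD, rosenD, e, ← Int.floor_add_one]
    congr 1
    ring
  refine ⟨hD, ?_⟩
  rw [rosenT, rosenT, if_neg hx.ne, if_neg hy.ne', hD, abs_of_neg (one_div_neg.mpr hx),
    abs_of_pos (one_div_pos.mpr hy)]
  push_cast
  linarith

/-- for odd `q = 2h+3`, `α ∈ (α₀, 1/2)`: `l_{2h+1} < 0 < r_{2h+1}`,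
`d_α(l_{2h+1}) = d_α(r_{2h+1}) + 1`, and `l_{2h+2} = r_{2h+2}`. -/
theorem stmt13 (h q : ℕ) (hh : 1 ≤ h) (hq : q = 2 * h + 3)
    (lam : ℝ) (hlam : lam = 2 * Real.cos (Real.pi / (q : ℝ)))
    (a : ℝ)
    (ha0 : (lam - 2 + Real.sqrt (2 * lam ^ 2 - 4 * lam + 4)) / lam ^ 2 < a)
    (ha1 : a < 1 / 2) :
    (rosenT lam a)^[2 * h + 1] ((a - 1) * lam) < 0 ∧
    0 < (rosenT lam a)^[2 * h + 1] (a * lam) ∧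
    rosenD lam a ((rosenT lam a)^[2 * h + 1] ((a - 1) * lam)) =
      rosenD lam a ((rosenT lam a)^[2 * h + 1] (a * lam)) + 1 ∧
    (rosenT lam a)^[2 * h + 2] ((a - 1) * lam) = (rosenT lam a)^[2 * h + 2] (a * lam) := by
  obtain ⟨m, rfl⟩ : ∃ m, h = m + 1 := ⟨h - 1, by omega⟩
  obtain rfl : q = 2 * m + 5 := by omega
  have hqr : (3 : ℝ) < (2 * m + 5 : ℕ) := by exact_mod_cast (by omega : 3 < 2 * m + 5)
  have h1 : 1 < lam := by
    have : cos (π / 3) < cos (π / (2 * m + 5 : ℕ)) := by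
      apply cos_lt_cos_of_nonneg_of_le_pi (by positivity) (by linarith [pi_pos])
      exact div_lt_div_of_pos_left pi_pos (by norm_num) hqr
    rw [cos_pi_div_three] at this
    linarith
  have h2 : lam < 2 := by
    have : cos (π / (2 * m + 5 : ℕ)) < cos 0 := by
      apply cos_lt_cos_of_nonneg_of_le_pi le_rfl
      · exact div_le_self pi_pos.le (by linarith)
      · positivity
    rw [cos_zero] at this
    linarith
  have h0 : 0 < lam := by linarith
  have hroot : sqrt (2 * lam ^ 2 - 4 * lam + 4) < a * lam ^ 2 - (lam - 2) := by
    rw [div_lt_iff₀ (by positivity)] at ha0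
    linarith
  have hP : 1 < lam ^ 2 * a ^ 2 + (4 - 2 * lam) * a := by
    have h3 := lt_sq_of_sqrt_lt hroot
    have : lam ^ 2 * 1 < lam ^ 2 * (lam ^ 2 * a ^ 2 + (4 - 2 * lam) * a) := by nlinarith
    exact lt_of_mul_lt_mul_left this (by positivity)
  have hapos : 0 < a := by
    refine lt_of_le_of_lt (div_nonneg ?_ (by positivity)) ha0
    have : 2 - lam ≤ sqrt (2 * lam ^ 2 - 4 * lam + 4) := by
      apply le_sqrt_of_sq_le
      nlinarith
    linarith
  have hii : 2 * lam - 2 < lam ^ 2 * a := by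
    by_contra! hc
    nlinarith [mul_le_mul_of_nonneg_right hc hapos.le, sq_nonneg (lam - 2)]
  have hiii : lam - 1 < a ^ 2 * lam ^ 2 := by
    by_contra! hc
    nlinarith
  have hla : a * lam < lam / 2 := by nlinarith
  have hr : (rosenT lam a)^[2 * (m + 1) + 1] (a * lam) =
      -(2 * (a * lam) - lam) / (lam * (a * lam) - 2 * lam + 2) := by
    rw [Function.iterate_succ_apply, ← rosenT_neg, ← Function.iterate_succ_apply]
    refine rosenT_iterate_two_mul_add_one rfl hlam h1 h2 hapos (by linarith) (by linarith) ?_ ?_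
    · nlinarith [sq_nonneg (a * lam - 1), mul_pos hapos h0]
    · rw [div_lt_iff₀ (by linarith)]
      nlinarith
  have hl : (rosenT lam a)^[2 * (m + 1) + 1] ((a - 1) * lam) =
      -(2 * ((1 - a) * lam) - lam) / (lam * ((1 - a) * lam) - 2 * lam + 2) := by
    have e : (a - 1) * lam = -((1 - a) * lam) := by ring
    rw [e]
    refine rosenT_iterate_two_mul_add_one rfl hlam h1 h2 hapos le_rfl (by nlinarith) ?_ ?_
    · nlinarith
    · refine lt_trans (div_neg_of_neg_of_pos ?_ ?_) (mul_pos hapos h0)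
      · linarith
      · nlinarith
  have hden_r : 0 < lam * (a * lam) - 2 * lam + 2 := by linarith
  have hden_l : 0 < lam * ((1 - a) * lam) - 2 * lam + 2 := by nlinarith
  have hneg : (rosenT lam a)^[2 * (m + 1) + 1] ((a - 1) * lam) < 0 := by
    rw [hl]
    exact div_neg_of_neg_of_pos (by linarith) hden_l
  have hpos : 0 < (rosenT lam a)^[2 * (m + 1) + 1] (a * lam) := by
    rw [hr]
    exact div_pos (by linarith) hden_r
  have hsum : 1 / (rosenT lam a)^[2 * (m + 1) + 1] ((a - 1) * lam) +
      1 / (rosenT lam a)^[2 * (m + 1) + 1] (a * lam) = -lam := by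
    have ha2 : 1 - 2 * a ≠ 0 := by linarith
    have e1 : -(2 * ((1 - a) * lam) - lam) = -(lam * (1 - 2 * a)) := by ring
    have e2 : -(2 * (a * lam) - lam) = lam * (1 - 2 * a) := by ring
    rw [hl, hr, e1, e2, one_div_div, one_div_div, div_neg, neg_add_eq_sub, ← sub_div,
      div_eq_iff (mul_ne_zero h0.ne' ha2)]
    ring
  obtain ⟨hD, hT⟩ := rosenD_rosenT_of_inv_add_inv a h0 hneg hpos hsum
  refine ⟨hneg, hpos, hD, ?_⟩
  rw [Function.iterate_succ_apply' _ (2 * (m + 1) + 1) ((a - 1) * lam),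
    Function.iterate_succ_apply' _ (2 * (m + 1) + 1) (a * lam), hT]
end

section
/- Let q = 3 (so λ = 1) and let α ∈ (√2 − 1, 1/2). With A_0 = [α−1, −1/2) × [0, g²) and D_0 = [α, 1/2) × [0, g), one has the exact image identities 𝒯_α(A_0) = [(2α−1)/(1−α), 0) × [1/2, g) and 𝒯_α(D_0) = (0, (1−2α)/α] × (g², 1/2]. -/
open Real MeasureTheory Set

/-- The small golden number `g = (√5 − 1)/2`. -/
noncomputable def gold : ℝ := (Real.sqrt 5 - 1) / 2

/-- The NICF natural-extension domain `Ω_{1/2}` for `q = 3`. -/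
noncomputable def Omega3 : Set (ℝ × ℝ) :=
  Set.Ico (-(1 : ℝ) / 2) 0 ×ˢ Set.Ico (0 : ℝ) (gold ^ 2) ∪
    Set.Ico (0 : ℝ) (1 / 2) ×ˢ Set.Ico (0 : ℝ) gold

/-- The region of changed digits `C`. -/
noncomputable def changedDigits (lam a : ℝ) (Om : Set (ℝ × ℝ)) : Set (ℝ × ℝ) :=
  {z ∈ Om | z.1 ≠ 0 ∧ z.1 ∈ Set.Ico ((a - 1) * lam) (a * lam) ∧
    z.1 ∈ Set.Ico ((1 / 2 - 1) * lam) (1 / 2 * lam) ∧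
    rosenD lam a z.1 ≠ rosenD lam (1 / 2) z.1}

theorem gold_sq : gold ^ 2 = 1 - gold := by
  have h : Real.sqrt 5 ^ 2 = 5 := Real.sq_sqrt (by norm_num)
  unfold gold
  linarith

theorem gold_pos : 0 < gold := by
  have h : 1 < Real.sqrt 5 := Real.lt_sqrt_of_sq_lt (by norm_num)
  unfold gold
  linarith

theorem gold_lt_one : gold < 1 := by
  have h : Real.sqrt 5 < 3 := (Real.sqrt_lt' (by norm_num)).2 (by norm_num)
  unfold gold
  linarith

/-- Where `|1/x| ∈ [a + 1, a + 2)`, the digit `d_a(x)` for `λ = 1` is `2`. -/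
theorem rosenD_one_eq_two {a x : ℝ} (h1 : a + 1 ≤ |1 / x|) (h2 : |1 / x| < a + 2) :
    rosenD 1 a x = 2 := by
  unfold rosenD
  rw [one_mul, Int.floor_eq_iff]
  push_cast
  constructor <;> linarith

theorem rosenTT_one_of_neg {a x : ℝ} (y : ℝ) (ha : a < 1 / 2) (ha' : 0 < a)
    (hx : x ∈ Ico (a - 1) (-(1 : ℝ) / 2)) :
    rosenTT 1 a (x, y) = (1 / (-x) - 2, 1 / (2 - y)) := by
  obtain ⟨h1, h2⟩ := hx
  have hx0 : x < 0 := by linarith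
  have habs : |1 / x| = 1 / (-x) := by
    rw [abs_div, abs_one, abs_of_neg hx0]
  have hd : rosenD 1 a x = 2 := by
    apply rosenD_one_eq_two
    · rw [habs, le_div_iff₀ (by linarith)]
      nlinarith [sq_nonneg a]
    · rw [habs, div_lt_iff₀ (by linarith)]
      nlinarith
  simp only [rosenTT, rosenT, hd, if_neg hx0.ne, habs, Real.sign_of_neg hx0]
  push_cast
  ring_nf

theorem rosenTT_one_of_pos {a x : ℝ} (y : ℝ) (ha : Real.sqrt 2 - 1 < a) (ha' : a < 1 / 2)
    (hx : x ∈ Ico a (1 / 2 : ℝ)) :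
    rosenTT 1 a (x, y) = (1 / x - 2, 1 / (2 + y)) := by
  obtain ⟨h1, h2⟩ := hx
  have hs : 1 < Real.sqrt 2 := Real.lt_sqrt_of_sq_lt (by norm_num)
  have hsq : Real.sqrt 2 ^ 2 = 2 := Real.sq_sqrt (by norm_num)
  have hx0 : 0 < x := by linarith
  have habs : |1 / x| = 1 / x := abs_of_pos (by positivity)
  have hd : rosenD 1 a x = 2 := by
    apply rosenD_one_eq_two
    · rw [habs, le_div_iff₀ hx0]
      nlinarith
    · rw [habs, div_lt_iff₀ hx0]
      nlinarith
  simp only [rosenTT, rosenT, hd, if_neg hx0.ne', habs, Real.sign_of_pos hx0]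
  push_cast
  ring_nf

/-- for `q = 3` (so `λ = 1`) and `α ∈ (√2 − 1, 1/2)`, the exact image
identities `𝒯_α(A₀) = [(2α−1)/(1−α), 0) × [1/2, g)` and
`𝒯_α(D₀) = (0, (1−2α)/α] × (g², 1/2]` hold. -/
theorem stmt16 (lam : ℝ) (hlam : lam = 2 * Real.cos (Real.pi / 3))
    (a : ℝ) (ha0 : Real.sqrt 2 - 1 < a) (ha1 : a < 1 / 2) :
    rosenTT lam a '' (Set.Ico (a - 1) (-(1 : ℝ) / 2) ×ˢ Set.Ico (0 : ℝ) (gold ^ 2)) =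
      Set.Ico ((2 * a - 1) / (1 - a)) (0 : ℝ) ×ˢ Set.Ico (1 / 2 : ℝ) gold ∧
    rosenTT lam a '' (Set.Ico a (1 / 2 : ℝ) ×ˢ Set.Ico (0 : ℝ) gold) =
      Set.Ioc (0 : ℝ) ((1 - 2 * a) / a) ×ˢ Set.Ioc (gold ^ 2) (1 / 2 : ℝ) := by
  have hl : lam = 1 := by rw [hlam, Real.cos_pi_div_three]; norm_num
  subst hl
  have hs : 1 < Real.sqrt 2 := Real.lt_sqrt_of_sq_lt (by norm_num)
  have ha : 0 < a := by linarith
  have hg := gold_sq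
  have hg0 := gold_pos
  have hg1 := gold_lt_one
  constructor
  · ext ⟨u, v⟩
    constructor
    · rintro ⟨⟨x, y⟩, ⟨hx, hy⟩, h⟩
      rw [rosenTT_one_of_neg y ha1 ha hx, Prod.mk.injEq] at h
      obtain ⟨rfl, rfl⟩ := h
      obtain ⟨hx1, hx2⟩ := hx
      obtain ⟨hy1, hy2⟩ := hy
      dsimp only at hx1 hx2 hy1 hy2
      refine ⟨⟨?_, ?_⟩, ?_, ?_⟩ <;> dsimp only
      · have h1 : (2 * a - 1) / (1 - a) = 1 / (1 - a) - 2 := by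
          have : 1 - a ≠ 0 := by linarith
          field_simp
          ring
        have h2 : 1 / (1 - a) ≤ 1 / (-x) :=
          one_div_le_one_div_of_le (by linarith) (by linarith)
        linarith
      · rw [sub_neg, div_lt_iff₀ (by linarith)]
        linarith
      · exact one_div_le_one_div_of_le (by linarith) (by linarith)
      · rw [div_lt_iff₀ (by linarith)]
        nlinarith
    · rintro ⟨⟨hu1, hu2⟩, hv1, hv2⟩
      dsimp only at hu1 hu2 hv1 hv2
      rw [div_le_iff₀ (by linarith)] at hu1
      have hu : 0 < u + 2 := by nlinarith
      have hv : 0 < v := by linarith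
      have hx : -(1 / (u + 2)) ∈ Ico (a - 1) (-(1 : ℝ) / 2) := by
        constructor
        · have : 1 / (u + 2) ≤ 1 - a := by
            rw [div_le_iff₀ hu]
            linarith
          linarith
        · have : 1 / 2 < 1 / (u + 2) := one_div_lt_one_div_of_lt hu (by linarith)
          linarith
      refine ⟨(-(1 / (u + 2)), 2 - 1 / v), ⟨hx, ?_, ?_⟩, ?_⟩
      · have : 1 / v ≤ 2 := by
          rw [div_le_iff₀ hv]
          linarith
        dsimp only
        linarith
      · have : 1 + gold < 1 / v := by
          rw [lt_div_iff₀ hv]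
          nlinarith
        dsimp only
        linarith
      · rw [rosenTT_one_of_neg _ ha1 ha hx]
        simp
  · ext ⟨u, v⟩
    constructor
    · rintro ⟨⟨x, y⟩, ⟨hx, hy⟩, h⟩
      rw [rosenTT_one_of_pos y ha0 ha1 hx, Prod.mk.injEq] at h
      obtain ⟨rfl, rfl⟩ := h
      obtain ⟨hx1, hx2⟩ := hx
      obtain ⟨hy1, hy2⟩ := hy
      dsimp only at hx1 hx2 hy1 hy2
      refine ⟨⟨?_, ?_⟩, ?_, ?_⟩ <;> dsimp only
      · rw [sub_pos, lt_div_iff₀ (by linarith)]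
        linarith
      · have h1 : (1 - 2 * a) / a = 1 / a - 2 := by
          field_simp
        have h2 : 1 / x ≤ 1 / a := one_div_le_one_div_of_le ha hx1
        linarith
      · rw [lt_div_iff₀ (by linarith)]
        nlinarith
      · exact one_div_le_one_div_of_le (by norm_num) (by linarith)
    · rintro ⟨⟨hu1, hu2⟩, hv1, hv2⟩
      dsimp only at hu1 hu2 hv1 hv2
      rw [le_div_iff₀ ha] at hu2
      have hu : 0 < u + 2 := by linarith
      have hv : 0 < v := by linarith
      have hx : 1 / (u + 2) ∈ Ico a (1 / 2 : ℝ) := by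
        constructor
        · rw [le_div_iff₀ hu]
          linarith
        · exact one_div_lt_one_div_of_lt (by norm_num) (by linarith)
      refine ⟨(1 / (u + 2), 1 / v - 2), ⟨hx, ?_, ?_⟩, ?_⟩
      · have : 2 ≤ 1 / v := by
          rw [le_div_iff₀ hv]
          linarith
        dsimp only
        linarith
      · have : 1 / v < 2 + gold := by
          rw [div_lt_iff₀ hv]
          nlinarith
        dsimp only
        linarith
      · rw [rosenTT_one_of_pos _ ha0 ha1 hx]
        simp
end
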